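/- A_n q-Pfaff–Saalschütz summation over a simplex: Let n be a positive integer, N a nonnegative integer, q a nonzero complex number that is not a root of unity, and a_1, …, a_n, b, c, x_1, …, x_n nonzero complex numbers, generic so that no denominator below vanishes. Then ∑_{k_1,…,k_n ≥ 0, |k| ≤ N} ∏_{1≤i<j≤n} (x_i·q^{k_i} − x_j·q^{k_j})/(x_i − x_j) · ∏_{i,j=1}^n (a_j·x_i/x_j; q)_{k_i}/(q·x_i/x_j; q)_{k_i} · ∏_{i=1}^n (b·x_i; q)_{k_i}/(c·x_i; q)_{k_i} · (q^{−N}; q)_{|k|}/(a_1⋯a_n·b·q^{1−N}/c; q)_{|k|} · q^{|k|} = (c/b; q)_N/(c/(a_1⋯a_n·b); q)_N · ∏_{i=1}^n (c·x_i/a_i; q)_N/(c·x_i; q)_N, where |k| = k_1 + ⋯ + k_n. -/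

import Mathlib

open Finset

/-- The q-shifted factorial `(a;q)_k`. -/
noncomputable def qPoch (q a : ℂ) (k : ℕ) : ℂ := ∏ i ∈ Finset.range k, (1 - a * q ^ i)

section Lemmas

variable {ι : Type*}

/-- Multiply the `i`-th coordinate by `q`. -/
def scaleAt [DecidableEq ι] (q : ℂ) (i : ι) (x : ι → ℂ) : ι → ℂ :=
  fun j => if j = i then q * x j else x j

theorem scaleAt_same [DecidableEq ι] (q : ℂ) (i : ι) (x : ι → ℂ) :
    scaleAt q i x i = q * x i := by simp [scaleAt]

theorem scaleAt_of_ne [DecidableEq ι] (q : ℂ) {i j : ι} (h : j ≠ i) (x : ι → ℂ) :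
    scaleAt q i x j = x j := by simp [scaleAt, h]

/-- Raise the `i`-th coordinate by one. -/
def raiseAt [DecidableEq ι] (i : ι) (k : ι → ℕ) : ι → ℕ :=
  fun j => if j = i then k j + 1 else k j

theorem raiseAt_same [DecidableEq ι] (i : ι) (k : ι → ℕ) : raiseAt i k i = k i + 1 := by
  simp [raiseAt]

theorem raiseAt_of_ne [DecidableEq ι] {i j : ι} (h : j ≠ i) (k : ι → ℕ) :
    raiseAt i k j = k j := by simp [raiseAt, h]

variable [Fintype ι]

theorem qPoch_succ (q a : ℂ) (k : ℕ) : qPoch q a (k + 1) = qPoch q a k * (1 - a * q ^ k) :=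
  Finset.prod_range_succ _ _

theorem qPoch_succ' (q a : ℂ) (k : ℕ) : qPoch q a (k + 1) = (1 - a) * qPoch q (q * a) k := by
  simp only [qPoch, Finset.prod_range_succ', pow_succ, pow_zero, mul_one]
  rw [mul_comm]
  congr 1
  exact Finset.prod_congr rfl fun i _ => by ring

theorem qPoch_ne_zero_iff (q a : ℂ) (k : ℕ) :
    qPoch q a k ≠ 0 ↔ ∀ s < k, 1 - a * q ^ s ≠ 0 := by
  simp [qPoch, Finset.prod_ne_zero_iff]

/-- Partial fractions: Lagrange interpolation of `∏ (z - y j) - ∏ (z - x j)` at the nodes `x i`,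
evaluated at `z = 0`. -/
theorem sum_prod_one_sub_div [DecidableEq ι] (x y : ι → ℂ) (hx : ∀ i, x i ≠ 0)
    (hinj : Function.Injective x) :
    ∑ i, (∏ j, (1 - y j / x i)) / ∏ j ∈ univ.erase i, (1 - x j / x i) = 1 - ∏ j, y j / x j := by
  have hdeg : (∏ j, (Polynomial.X - Polynomial.C (y j)) -
      ∏ j, (Polynomial.X - Polynomial.C (x j))).degree < (#(univ : Finset ι) : WithBot ℕ) := by
    have hd (z : ι → ℂ) :
        (∏ j, (Polynomial.X - Polynomial.C (z j))).degree = (#(univ : Finset ι) : WithBot ℕ) := by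
      simp [Polynomial.degree_prod]
    have hm (z : ι → ℂ) : (∏ j, (Polynomial.X - Polynomial.C (z j))).Monic :=
      Polynomial.monic_prod_of_monic _ _ fun j _ => Polynomial.monic_X_sub_C _
    rw [← hd y]
    exact Polynomial.degree_sub_lt_left (by rw [hd, hd]) (hm y).ne_zero
      (by rw [(hm y).leadingCoeff, (hm x).leadingCoeff])
  have key := congrArg (Polynomial.eval 0)
    (Lagrange.eq_interpolate (v := x) (s := univ) hinj.injOn hdeg)
  simp only [Lagrange.interpolate_apply, Polynomial.eval_finsetSum, Polynomial.eval_mul,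
    Polynomial.eval_C, Lagrange.basis, Polynomial.eval_prod, Lagrange.basisDivisor,
    Polynomial.eval_sub, Polynomial.eval_X] at key
  have hne : -∏ j, (0 - x j) ≠ 0 :=
    neg_ne_zero.2 (Finset.prod_ne_zero_iff.2 fun j _ => by simpa using hx j)
  apply mul_right_cancel₀ hne
  have hR : (1 - ∏ j, y j / x j) * -∏ j, (0 - x j) = ∏ j, (0 - y j) - ∏ j, (0 - x j) := by
    have : ∏ j, (0 - y j) = (∏ j, y j / x j) * ∏ j, (0 - x j) := by
      rw [← Finset.prod_mul_distrib]
      exact Finset.prod_congr rfl fun j _ => by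
        have := hx j
        field_simp
        ring
    rw [this]; ring
  rw [hR, key, Finset.sum_mul]
  refine Finset.sum_congr rfl fun i _ => ?_
  have hxi := hx i
  have h0 : ∏ j, (x i - x j) = 0 := Finset.prod_eq_zero (mem_univ i) (sub_self _)
  have h1 : ∏ j, (x i - y j) = (x i * ∏ j ∈ univ.erase i, x i) * ∏ j, (1 - y j / x i) := by
    rw [Finset.mul_prod_erase univ (fun _ => x i) (mem_univ i), ← Finset.prod_mul_distrib]
    exact Finset.prod_congr rfl fun j _ => by field_simp
  have h2 : (∏ j, (0 - x j)) = -x i * ∏ j ∈ univ.erase i, (0 - x j) := by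
    rw [← Finset.mul_prod_erase univ _ (mem_univ i)]; ring
  have h3 : ∏ j ∈ univ.erase i, ((x i - x j)⁻¹ * (0 - x j)) * x i =
      (∏ j ∈ univ.erase i, (1 - x j / x i))⁻¹ * ∏ j ∈ univ.erase i, (0 - x j) := by
    rw [← Finset.prod_inv_distrib, ← Finset.prod_mul_distrib]
    refine Finset.prod_congr rfl fun j hj => ?_
    have : x i - x j ≠ 0 := sub_ne_zero.2 fun h => (Finset.ne_of_mem_erase hj) (hinj h).symm
    have h' : 1 - x j / x i = (x i - x j) / x i := by field_simp
    rw [h', inv_div]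
    field_simp
  rw [Finset.prod_mul_distrib] at h3
  rw [h0, h1, h2, sub_zero, div_eq_mul_inv]
  linear_combination (-(x i * ∏ j, (1 - y j / x i))) * h3

/-- Partial fraction expansion in `C` with poles at the points `1 / x i`. -/
theorem one_sub_mul_prod_eq_sum [DecidableEq ι] (x a : ι → ℂ) (b C : ℂ) (hx : ∀ i, x i ≠ 0)
    (hinj : Function.Injective x) (ha : ∀ i, a i ≠ 0) (hb : b ≠ 0) (hC : C ≠ 0)
    (hCx : ∀ i, 1 - C * x i ≠ 0) :
    (1 - C / b) * ∏ i, (1 - C * x i / a i) / (1 - C * x i) =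
      1 - C / ((∏ i, a i) * b) + C / ((∏ i, a i) * b) *
        ∑ i, (∏ j, (1 - a j * x i / x j)) / (∏ j ∈ univ.erase i, (1 - x i / x j)) *
          ((1 - b * x i) / (1 - C * x i)) := by
  have hA : ∏ i, a i ≠ 0 := Finset.prod_ne_zero_iff.2 fun i _ => ha i
  have hX : ∀ i : Option ι, i.elim (1 / C) x ≠ 0 := by
    rintro (_ | i)
    · exact one_div_ne_zero hC
    · exact hx i
  have hne : ∀ i, 1 / C ≠ x i := fun i h => hCx i (by rw [← h]; field_simp; ring)
  have hXinj : Function.Injective fun i : Option ι => i.elim (1 / C) x := by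
    rintro (_ | i) (_ | j) h
    · rfl
    · exact absurd h (hne j)
    · exact absurd h.symm (hne i)
    · exact congrArg some (hinj h)
  have key := sum_prod_one_sub_div (fun i : Option ι => i.elim (1 / C) x)
    (fun i : Option ι => i.elim (1 / b) fun j => x j / a j) hX hXinj
  have en : (univ : Finset (Option ι)).erase none = univ.map Function.Embedding.some := by
    ext (_ | j) <;> simp
  have es (i : ι) : (univ : Finset (Option ι)).erase (some i) =
      Finset.insertNone (univ.erase i) := by
    ext (_ | j) <;> simp
  simp only [Fintype.sum_option, Fintype.prod_option, en, es, Finset.prod_map,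
    Finset.prod_insertNone, Option.elim, Function.Embedding.some_apply] at key
  have t0 : (1 - 1 / b / (1 / C)) * (∏ j, (1 - x j / a j / (1 / C))) / ∏ j, (1 - x j / (1 / C)) =
      (1 - C / b) * ∏ i, (1 - C * x i / a i) / (1 - C * x i) := by
    rw [mul_div_assoc, ← Finset.prod_div_distrib]
    congr 1
    · field_simp
    · refine Finset.prod_congr rfl fun j _ => ?_
      congr 1
      · have := ha j
        field_simp
      · field_simp
  have t1 : 1 / b / (1 / C) * ∏ j, x j / a j / x j = C / ((∏ i, a i) * b) := by
    have : ∏ j, x j / a j / x j = (∏ j, a j)⁻¹ := by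
      rw [← Finset.prod_inv_distrib]
      refine Finset.prod_congr rfl fun j _ => ?_
      have := ha j
      have := hx j
      field_simp
    rw [this]
    field_simp
  have t2 (i : ι) : (1 - 1 / b / x i) * (∏ j, (1 - x j / a j / x i)) /
      ((1 - 1 / C / x i) * ∏ j ∈ univ.erase i, (1 - x j / x i)) =
      -(C / ((∏ i, a i) * b) * ((∏ j, (1 - a j * x i / x j)) /
        (∏ j ∈ univ.erase i, (1 - x i / x j)) * ((1 - b * x i) / (1 - C * x i)))) := by
    have hxi := hx i
    have hCi := hCx i
    have u1 : ∏ j ∈ univ.erase i, (1 - x i / x j) =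
        (∏ j ∈ univ.erase i, (-(x i / x j))) * ∏ j ∈ univ.erase i, (1 - x j / x i) := by
      rw [← Finset.prod_mul_distrib]
      refine Finset.prod_congr rfl fun j _ => ?_
      have := hx j
      field_simp
      ring
    have u2 : ∏ j, (1 - a j * x i / x j) =
        (∏ j, a j) * (-(∏ j ∈ univ.erase i, (-(x i / x j)))) * ∏ j, (1 - x j / a j / x i) := by
      have : -(∏ j ∈ univ.erase i, (-(x i / x j))) = ∏ j, (-(x i / x j)) := by
        rw [← Finset.mul_prod_erase univ _ (mem_univ i), div_self hxi]
        ring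
      rw [this, ← Finset.prod_mul_distrib, ← Finset.prod_mul_distrib]
      refine Finset.prod_congr rfl fun j _ => ?_
      have := hx j
      have := ha j
      field_simp
      ring
    have u3 : ∏ j ∈ univ.erase i, (-(x i / x j)) ≠ 0 :=
      Finset.prod_ne_zero_iff.2 fun j _ => neg_ne_zero.2 (div_ne_zero hxi (hx j))
    have u4 : ∏ j ∈ univ.erase i, (1 - x j / x i) ≠ 0 := by
      refine Finset.prod_ne_zero_iff.2 fun j hj h => Finset.ne_of_mem_erase hj (hinj ?_)
      rw [sub_eq_zero, eq_div_iff hxi, one_mul] at h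
      exact h.symm
    have u5 : 1 - 1 / C / x i = -(1 - C * x i) / (C * x i) := by field_simp; ring
    rw [u1, u2, u5]
    generalize ∏ j, (1 - x j / a j / x i) = t
    generalize (∏ j ∈ univ.erase i, (-(x i / x j))) = u at *
    generalize ∏ j ∈ univ.erase i, (1 - x j / x i) = v at *
    generalize ∏ j, a j = A at *
    field_simp
    ring
  rw [t0, t1] at key
  simp only [t2, Finset.sum_neg_distrib, ← Finset.mul_sum] at key
  linear_combination key

theorem prod_prod_eq_cross [DecidableEq ι] (h : ι → ι → ℂ) (i : ι)
    (hh : ∀ l j, l ≠ i → j ≠ i → h l j = 1) :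
    ∏ l, ∏ j, h l j = h i i * ∏ j ∈ univ.erase i, (h i j * h j i) := by
  rw [← Finset.mul_prod_erase univ _ (mem_univ i),
    ← Finset.mul_prod_erase univ (h i) (mem_univ i), Finset.prod_mul_distrib, mul_assoc]
  congr 2
  refine Finset.prod_congr rfl fun l hl => ?_
  exact Finset.prod_eq_single i (fun j _ hj => hh l j (Finset.ne_of_mem_erase hl) hj) (by simp)

/-- The points of `ι → ℕ` with `|k| ≤ N`. -/
def natSimplex (ι : Type*) [Fintype ι] [DecidableEq ι] (N : ℕ) : Finset (ι → ℕ) :=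
  Finset.filter (fun k => ∑ i, k i ≤ N) (Fintype.piFinset fun _ => Finset.range (N + 1))

theorem mem_natSimplex [DecidableEq ι] {N : ℕ} {k : ι → ℕ} :
    k ∈ natSimplex ι N ↔ ∑ i, k i ≤ N := by
  simp only [natSimplex, Finset.mem_filter, Fintype.mem_piFinset, Finset.mem_range,
    and_iff_right_iff_imp]
  intro h i
  have := Finset.single_le_sum (f := k) (fun _ _ => Nat.zero_le _) (mem_univ i)
  omega

theorem prod_scaleAt [DecidableEq ι] (q : ℂ) (i : ι) (x : ι → ℂ) :
    ∏ j, scaleAt q i x j = q * ∏ j, x j := by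
  rw [← Finset.mul_prod_erase univ _ (mem_univ i), ← Finset.mul_prod_erase univ x (mem_univ i),
    scaleAt_same, mul_assoc]
  congr 2
  exact Finset.prod_congr rfl fun j hj => scaleAt_of_ne q (Finset.ne_of_mem_erase hj) x

theorem sum_raiseAt [DecidableEq ι] (i : ι) (k : ι → ℕ) :
    ∑ j, raiseAt i k j = ∑ j, k j + 1 := by
  rw [← Finset.add_sum_erase univ _ (mem_univ i), ← Finset.add_sum_erase univ k (mem_univ i),
    raiseAt_same, Finset.sum_congr rfl fun j hj => raiseAt_of_ne (Finset.ne_of_mem_erase hj) k]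
  ring

theorem sum_natSimplex_succ [DecidableEq ι] (N : ℕ) (i : ι) (f : (ι → ℕ) → ℂ)
    (hf : ∀ k, k i = 0 → f k = 0) :
    ∑ k ∈ natSimplex ι (N + 1), f k = ∑ k ∈ natSimplex ι N, f (raiseAt i k) := by
  symm
  refine Finset.sum_bij_ne_zero (fun k _ _ => raiseAt i k) ?_ ?_ ?_ ?_
  · intro k hk _
    rw [mem_natSimplex] at hk ⊢
    rw [sum_raiseAt]; omega
  · intro k _ _ l _ _ h
    funext j
    have := congrFun h j
    by_cases hj : j = i <;> simpa [raiseAt, hj] using this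
  · intro k hk hk0
    have hki : k i ≠ 0 := fun h => hk0 (hf k h)
    have hr : raiseAt i (fun j => if j = i then k j - 1 else k j) = k := by
      funext j
      by_cases hj : j = i
      · subst hj; simp only [raiseAt, if_true]; omega
      · simp [raiseAt, hj]
    refine ⟨fun j => if j = i then k j - 1 else k j, ?_, by rwa [hr], hr⟩
    rw [mem_natSimplex] at hk ⊢
    have := sum_raiseAt i (fun j => if j = i then k j - 1 else k j)
    rw [hr] at this
    omega
  · intros; rfl

variable [LinearOrder ι]

/-- The part of the summand which does not depend on `N`. -/
noncomputable def multiTerm (q b c : ℂ) (x a : ι → ℂ) (k : ι → ℕ) : ℂ :=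
  (∏ i, ∏ j, if i < j then (x i * q ^ k i - x j * q ^ k j) / (x i - x j) else 1) *
    (∏ i, ∏ j, qPoch q (a j * x i / x j) (k i) / qPoch q (q * x i / x j) (k i)) *
    ∏ i, qPoch q (b * x i) (k i) / qPoch q (c * x i) (k i)

theorem prod_qPoch_div_raiseAt (q b c : ℂ) (x : ι → ℂ) (i : ι) (k : ι → ℕ) :
    ∏ j, qPoch q (b * x j) (raiseAt i k j) / qPoch q (c * x j) (raiseAt i k j) =
      (1 - b * x i) / (1 - c * x i) *
        ∏ j, qPoch q (b * scaleAt q i x j) (k j) / qPoch q (c * scaleAt q i x j) (k j) := by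
  rw [← Finset.mul_prod_erase univ _ (mem_univ i),
    ← Finset.mul_prod_erase univ
      (fun j => qPoch q (b * scaleAt q i x j) (k j) / qPoch q (c * scaleAt q i x j) (k j))
      (mem_univ i), raiseAt_same, scaleAt_same, qPoch_succ', qPoch_succ',
    mul_left_comm b q, mul_left_comm c q, mul_div_mul_comm, mul_assoc]
  congr 2
  refine Finset.prod_congr rfl fun j hj => ?_
  have hj := Finset.ne_of_mem_erase hj
  rw [raiseAt_of_ne hj, scaleAt_of_ne q hj]

theorem multiTerm_raiseAt (q b c : ℂ) (x a : ι → ℂ) (i : ι) (k : ι → ℕ) (N : ℕ)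
    (hq : q ≠ 0) (hqru : ∀ m : ℕ, 0 < m → q ^ m ≠ 1) (hx : ∀ j, x j ≠ 0)
    (hxd : ∀ l j, l ≠ j → ∀ s ≤ N, x l * q ^ s ≠ x j) (hN : 1 ≤ N) (hk : ∀ j, k j ≤ N) :
    multiTerm q b c x a (raiseAt i k) *
      ((∏ j, (1 - x j * q ^ raiseAt i k j / x i)) / ∏ j ∈ univ.erase i, (1 - x j / x i)) =
    (∏ j, (1 - a j * x i / x j)) / (∏ j ∈ univ.erase i, (1 - x i / x j)) *
      ((1 - b * x i) / (1 - c * x i)) * multiTerm q b c (scaleAt q i x) (scaleAt q i a) k := by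
  have hxne : ∀ l j, l ≠ j → x l - x j ≠ 0 := fun l j h =>
    sub_ne_zero.2 (by simpa using hxd l j h 0 (Nat.zero_le _))
  have hxne1 : ∀ l j, l ≠ j → q * x l - x j ≠ 0 := fun l j h =>
    sub_ne_zero.2 (by simpa [mul_comm] using hxd l j h 1 hN)
  have hxne1' : ∀ l j, l ≠ j → x l - q * x j ≠ 0 := fun l j h => by
    rw [← neg_sub]; exact neg_ne_zero.2 (hxne1 j l h.symm)
  have hsc : ∀ l, x l * q ^ raiseAt i k l = scaleAt q i x l * q ^ k l := fun l => by
    by_cases hl : l = i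
    · subst hl; rw [raiseAt_same, scaleAt_same, pow_succ]; ring
    · rw [raiseAt_of_ne hl, scaleAt_of_ne q hl]
  have hscne : ∀ l j, l ≠ j → scaleAt q i x l - scaleAt q i x j ≠ 0 := fun l j h => by
    by_cases hl : l = i
    · subst hl; rw [scaleAt_same, scaleAt_of_ne q h.symm]; exact hxne1 l j h
    · rw [scaleAt_of_ne q hl]
      by_cases hj : j = i
      · subst hj; rw [scaleAt_same]; exact hxne1' l j h
      · rw [scaleAt_of_ne q hj]; exact hxne l j h
  set V : ι → ι → ℂ := fun l j => if l < j then
    (scaleAt q i x l - scaleAt q i x j) / (x l - x j) else 1 with hV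
  set W : ι → ι → ℂ := fun l j =>
    if l = i then (if j = i then (1 - a i) / (1 - q ^ (k i + 1)) else
        (1 - a j * x i / x j) / (1 - q * x i / x j))
      else (if j = i then (1 - x l / x i) / (1 - x l * q ^ k l / x i) else 1) with hW
  have hVoff : ∀ l j, l ≠ i → j ≠ i → V l j = 1 := fun l j hl hj => by
    simp only [hV, scaleAt_of_ne q hl, scaleAt_of_ne q hj]
    split_ifs with h
    · exact div_self (hxne l j h.ne)
    · rfl
  have hVent : ∀ l j,
      (if l < j then (x l * q ^ raiseAt i k l - x j * q ^ raiseAt i k j) / (x l - x j) else 1) =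
      (if l < j then (scaleAt q i x l * q ^ k l - scaleAt q i x j * q ^ k j) /
          (scaleAt q i x l - scaleAt q i x j) else 1) * V l j := fun l j => by
    simp only [hV, hsc]
    split_ifs with h
    · rw [div_mul_div_cancel₀ (hscne l j h.ne)]
    · rw [mul_one]
  have hWent : ∀ l j,
      qPoch q (a j * x l / x j) (raiseAt i k l) / qPoch q (q * x l / x j) (raiseAt i k l) =
      qPoch q (scaleAt q i a j * scaleAt q i x l / scaleAt q i x j) (k l) /
          qPoch q (q * scaleAt q i x l / scaleAt q i x j) (k l) * W l j := by
    intro l j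
    have hxi := hx i
    have hxj := hx j
    by_cases hl : l = i
    · subst hl
      rw [raiseAt_same, scaleAt_same]
      by_cases hj : j = l
      · subst hj
        simp only [hW, if_true, scaleAt_same]
        rw [qPoch_succ', qPoch_succ]
        have e1 : q * (a j * x j / x j) = q * a j * (q * x j) / (q * x j) := by field_simp
        have e2 : a j * x j / x j = a j := by field_simp
        have e3 : q * x j / x j = q := by field_simp
        have e4 : q * (q * x j) / (q * x j) = q := by field_simp
        rw [e1, e2, e3, e4, mul_comm (1 - a j), mul_div_mul_comm, pow_succ']
      · simp only [hW, if_true, if_neg hj, scaleAt_of_ne q hj]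
        have e1 : q * (a j * x l / x j) = a j * (q * x l) / x j := by ring
        have e2 : q * (q * x l / x j) = q * (q * x l) / x j := by ring
        rw [qPoch_succ', qPoch_succ', e1, e2, mul_comm (1 - a j * x l / x j),
          mul_comm (1 - q * x l / x j), mul_div_mul_comm]
    · rw [raiseAt_of_ne hl, scaleAt_of_ne q hl]
      by_cases hj : j = i
      · subst hj
        simp only [hW, if_neg hl, if_true, scaleAt_same]
        have e1 : q * a j * x l / (q * x j) = a j * x l / x j := by field_simp
        have e2 : q * x l / (q * x j) = x l / x j := by field_simp
        have e3 := (qPoch_succ q (x l / x j) (k l)).symm.trans (qPoch_succ' q (x l / x j) (k l))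
        have e4 : q * (x l / x j) = q * x l / x j := by ring
        have n1 : 1 - x l / x j * q ^ k l ≠ 0 := by
          have := sub_ne_zero.2 (hxd l j hl _ (hk l))
          intro h
          apply this
          field_simp at h
          linear_combination -h
        have n2 : 1 - x l / x j ≠ 0 := by
          have := hxne l j hl
          intro h
          apply this
          field_simp at h
          linear_combination -h
        rw [e4] at e3
        have e5 : qPoch q (x l / x j) (k l) =
            (1 - x l / x j) * qPoch q (q * x l / x j) (k l) / (1 - x l / x j * q ^ k l) := by
          rw [← e3, mul_div_cancel_right₀ _ n1]
        have e6 : x l * q ^ k l / x j = x l / x j * q ^ k l := by ring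
        rw [e1, e2, e5, e6, div_mul_div_comm, div_mul_cancel₀ _ n1, mul_comm (1 - x l / x j),
          mul_div_mul_right _ _ n2]
      · simp only [hW, if_neg hl, if_neg hj, scaleAt_of_ne q hj, mul_one]
  have hprod : multiTerm q b c x a (raiseAt i k) =
      multiTerm q b c (scaleAt q i x) (scaleAt q i a) k * (∏ l, ∏ j, V l j * W l j) *
        ((1 - b * x i) / (1 - c * x i)) := by
    simp only [multiTerm]
    rw [prod_qPoch_div_raiseAt]
    simp only [hVent, hWent, Finset.prod_mul_distrib]
    ring
  have hcross : (∏ l, ∏ j, V l j * W l j) *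
      ((∏ j, (1 - x j * q ^ raiseAt i k j / x i)) / ∏ j ∈ univ.erase i, (1 - x j / x i)) =
      (∏ j, (1 - a j * x i / x j)) / (∏ j ∈ univ.erase i, (1 - x i / x j)) := by
    rw [prod_prod_eq_cross _ i (fun l j hl hj => by simp [hVoff l j hl hj, hW, hl, hj]),
      ← Finset.mul_prod_erase univ (fun j => 1 - x j * q ^ raiseAt i k j / x i) (mem_univ i),
      ← Finset.mul_prod_erase univ (fun j => 1 - a j * x i / x j) (mem_univ i),
      mul_div_assoc (1 - x i * q ^ raiseAt i k i / x i), mul_div_assoc (1 - a i * x i / x i),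
      mul_mul_mul_comm, ← Finset.prod_div_distrib,
      ← Finset.prod_div_distrib, ← Finset.prod_mul_distrib]
    congr 1
    · have := sub_ne_zero.2 (hqru (k i + 1) (Nat.succ_pos _)).symm
      have hxi := hx i
      simp only [hV, hW, if_true, lt_irrefl, if_false, raiseAt_same]
      field_simp
    · refine Finset.prod_congr rfl fun j hj => ?_
      have hj := Finset.ne_of_mem_erase hj
      have hxi := hx i
      have hxj := hx j
      have hVV : V i j * V j i = (q * x i - x j) / (x i - x j) := by
        have h1 := hxne i j hj.symm
        have h2 := hxne j i hj
        simp only [hV, scaleAt_same, scaleAt_of_ne q hj]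
        rcases lt_or_gt_of_ne hj with h | h
        · rw [if_pos h, if_neg h.asymm, one_mul, ← neg_sub, ← neg_sub (x i), neg_div_neg_eq]
        · rw [if_pos h, if_neg h.asymm, mul_one]
      have n1 := sub_ne_zero.2 (hxd j i hj _ (hk j))
      have n1' : x i - x j * q ^ k j ≠ 0 := by rw [← neg_sub]; exact neg_ne_zero.2 n1
      have n2 := hxne i j hj.symm
      have n2' := hxne j i hj
      have n3 := hxne1' j i hj
      have n3' := hxne1 i j hj.symm
      have d1 : 1 - q * x i / x j = (x j - q * x i) / x j := by field_simp
      have d2 : 1 - x j / x i = (x i - x j) / x i := by field_simp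
      have d3 : 1 - x j * q ^ k j / x i = (x i - x j * q ^ k j) / x i := by field_simp
      have d4 : 1 - x i / x j = (x j - x i) / x j := by field_simp
      rw [mul_mul_mul_comm (V i j), hVV, raiseAt_of_ne hj]
      simp only [hW, if_true, if_neg hj]
      rw [d1, d2, d3, d4]
      generalize 1 - a j * x i / x j = t
      field_simp
      ring
  rw [hprod]
  linear_combination (multiTerm q b c (scaleAt q i x) (scaleAt q i a) k *
    ((1 - b * x i) / (1 - c * x i))) * hcross

/-- The factor of the summand which depends on `N`, as a function of `m = |k|`. -/
noncomputable def simplexWeight (q w : ℂ) (N m : ℕ) : ℂ :=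
  w ^ m * (qPoch q w (N - m) / qPoch q q (N - m))

theorem qPoch_self_ne_zero {q : ℂ} (hqru : ∀ m : ℕ, 0 < m → q ^ m ≠ 1) (k : ℕ) :
    qPoch q q k ≠ 0 := by
  rw [qPoch_ne_zero_iff]
  intro s _
  rw [← pow_succ']
  exact sub_ne_zero.2 (hqru _ (Nat.succ_pos s)).symm

theorem simplexWeight_succ {q : ℂ} (hq : q ≠ 0) (hqru : ∀ m : ℕ, 0 < m → q ^ m ≠ 1) (w : ℂ)
    {N m : ℕ} (hm : m ≤ N + 1) :
    (1 - q ^ (N + 1)) * simplexWeight q w (N + 1) m =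
      (if m ≤ N then (1 - w * q ^ N) * simplexWeight q w N m else 0) +
        q ^ N * w * ((1 - q ^ m) * simplexWeight q (w / q) N (m - 1)) := by
  have hs (s : ℕ) : 1 - q * q ^ s ≠ 0 := by
    rw [← pow_succ']
    exact sub_ne_zero.2 (hqru _ (Nat.succ_pos s)).symm
  rcases m with _ | m
  · have h1 := hs N
    have h2 := qPoch_self_ne_zero hqru N
    simp only [simplexWeight, Nat.zero_le, if_true, pow_zero, Nat.sub_zero, qPoch_succ, pow_succ']
    field_simp
    ring
  · obtain ⟨r, rfl⟩ := Nat.exists_eq_add_of_le (Nat.succ_le_succ_iff.1 hm)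
    rcases r with _ | r
    · simp only [simplexWeight, add_zero, Nat.sub_self, Nat.add_sub_cancel, qPoch,
        Finset.prod_range_zero, div_pow]
      rw [if_neg (by omega)]
      field_simp
      ring
    · have h1 := hs r
      have h2 := qPoch_self_ne_zero hqru r
      have e1 : m + (r + 1) + 1 - (m + 1) = r + 1 := by omega
      have e2 : m + (r + 1) - (m + 1) = r := by omega
      have e3 : m + (r + 1) - m = r + 1 := by omega
      simp only [simplexWeight, e1, e2, Nat.add_sub_cancel, e3]
      rw [if_pos (by omega), qPoch_succ q w, qPoch_succ q q, qPoch_succ' q (w / q),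
        mul_div_cancel₀ w hq, div_pow]
      generalize qPoch q w r = W
      generalize qPoch q q r = Q at *
      simp only [pow_add, pow_one]
      generalize q ^ r = p at *
      have h3 : q ^ m ≠ 0 := pow_ne_zero m hq
      generalize q ^ m = t at *
      generalize hu : 1 - q * p = u at *
      field_simp
      rw [← hu]
      ring

theorem sum_multiTerm_mul_simplexWeight {q b c : ℂ} (hq : q ≠ 0)
    (hqru : ∀ m : ℕ, 0 < m → q ^ m ≠ 1) (hb : b ≠ 0) (hc : c ≠ 0) (N : ℕ) (x a : ι → ℂ)
    (hx : ∀ i, x i ≠ 0) (ha : ∀ i, a i ≠ 0)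
    (hxd : ∀ l j, l ≠ j → ∀ s ≤ N, x l * q ^ s ≠ x j)
    (hcx : ∀ i, ∀ s < N, 1 - c * x i * q ^ s ≠ 0) :
    ∑ k ∈ natSimplex ι N,
      multiTerm q b c x a k * simplexWeight q (c / ((∏ i, a i) * b)) N (∑ i, k i) =
      qPoch q (c / b) N / qPoch q q N *
        ∏ i, qPoch q (c * x i / a i) N / qPoch q (c * x i) N := by
  induction N generalizing x a with
  | zero =>
    have h0 : natSimplex ι 0 = {0} := by
      ext k
      simp [mem_natSimplex, funext_iff]
    have hV (i j : ι) : (if i < j then (x i * q ^ 0 - x j * q ^ 0) / (x i - x j) else 1) = 1 := by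
      split_ifs with h
      · rw [pow_zero, mul_one, mul_one, div_self]
        exact sub_ne_zero.2 (by simpa using hxd i j h.ne 0 le_rfl)
      · rfl
    rw [h0, Finset.sum_singleton]
    simp only [multiTerm, Pi.zero_apply, hV]
    simp [simplexWeight, qPoch]
  | succ N ih =>
    set w := c / ((∏ i, a i) * b) with hw
    set R := qPoch q (c / b) N / qPoch q q N *
      ∏ i, qPoch q (c * x i / a i) N / qPoch q (c * x i) N with hR
    set d : ι → ℂ := fun i => (∏ j, (1 - a j * x i / x j)) / (∏ j ∈ univ.erase i, (1 - x i / x j)) *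
      ((1 - b * x i) / (1 - c * x i)) with hd
    have hinj : Function.Injective x := fun l j h => by
      by_contra hne
      exact hxd l j hne 0 (Nat.zero_le _) (by simpa using h)
    have hcxN (i : ι) : 1 - c * x i * q ^ N ≠ 0 := hcx i N (Nat.lt_succ_self N)
    have hcx0 (i : ι) : 1 - c * x i ≠ 0 := by simpa using hcx i 0 (Nat.succ_pos N)
    have ih0 : ∑ k ∈ natSimplex ι N, multiTerm q b c x a k * simplexWeight q w N (∑ i, k i) = R :=
      ih x a hx ha (fun l j h s hs => hxd l j h s (by omega)) fun i s hs => hcx i s (by omega)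
    have ihs (i : ι) : ∑ k ∈ natSimplex ι N,
        multiTerm q b c (scaleAt q i x) (scaleAt q i a) k *
          simplexWeight q (w / q) N (∑ i, k i) =
        R * ((1 - c * x i) / (1 - c * x i * q ^ N)) := by
      have hne {y : ι → ℂ} (hy : ∀ j, y j ≠ 0) (j : ι) : scaleAt q i y j ≠ 0 := by
        by_cases hj : j = i
        · rw [hj, scaleAt_same]; exact mul_ne_zero hq (hy i)
        · rw [scaleAt_of_ne q hj]; exact hy j
      have hi := ih (scaleAt q i x) (scaleAt q i a) (hne hx) (hne ha) ?_ ?_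
      · have hwq : c / ((∏ j, scaleAt q i a j) * b) = w / q := by
          rw [prod_scaleAt, hw, div_div]
          congr 1
          ring
        rw [hwq] at hi
        rw [hi, hR, mul_assoc]
        congr 1
        rw [← Finset.mul_prod_erase univ _ (mem_univ i),
          ← Finset.mul_prod_erase univ (fun j => qPoch q (c * x j / a j) N / qPoch q (c * x j) N)
            (mem_univ i), mul_right_comm]
        congr 1
        · have e1 : c * (q * x i) / (q * a i) = c * x i / a i := by
            rw [mul_left_comm, mul_div_mul_left _ _ hq]
          have e2 := (qPoch_succ q (c * x i) N).symm.trans (qPoch_succ' q (c * x i) N)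
          have h1 := hcxN i
          have h2 := hcx0 i
          have e3 : qPoch q (c * x i) N =
              (1 - c * x i) * qPoch q (q * (c * x i)) N / (1 - c * x i * q ^ N) := by
            rw [← e2, mul_div_cancel_right₀ _ h1]
          rw [scaleAt_same, scaleAt_same, e1, e3, mul_left_comm c q, div_div_eq_mul_div,
            div_mul_div_comm, ← mul_div_mul_right _ _ (mul_ne_zero h1 h2)]
          congr 1 <;> ring
        · refine Finset.prod_congr rfl fun j hj => ?_
          have hj := Finset.ne_of_mem_erase hj
          rw [scaleAt_of_ne q hj, scaleAt_of_ne q hj]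
      · intro l j hlj s hs
        by_cases hl : l = i
        · subst hl
          rw [scaleAt_same, scaleAt_of_ne q hlj.symm]
          have := hxd l j hlj (s + 1) (by omega)
          rwa [pow_succ', ← mul_assoc, mul_comm (x l)] at this
        · rw [scaleAt_of_ne q hl]
          by_cases hj : j = i
          · subst hj
            rw [scaleAt_same]
            rcases s with _ | s
            · simpa [mul_comm] using (hxd j l hlj.symm 1 (by omega)).symm
            · intro h
              refine hxd l j hlj s (by omega) (mul_left_cancel₀ hq ?_)
              rw [← h, pow_succ']
              ring
          · rw [scaleAt_of_ne q hj]
            exact hxd l j hlj s (by omega)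
      · intro j s hs
        by_cases hj : j = i
        · subst hj
          rw [scaleAt_same]
          have := hcx j (s + 1) (by omega)
          rwa [pow_succ', ← mul_assoc, mul_assoc c, mul_comm (x j)] at this
        · rw [scaleAt_of_ne q hj]
          exact hcx j s (by omega)
    have hL (k : ι → ℕ) : ∑ i, (∏ j, (1 - x j * q ^ k j / x i)) /
        ∏ j ∈ univ.erase i, (1 - x j / x i) = 1 - q ^ ∑ i, k i := by
      rw [sum_prod_one_sub_div x (fun j => x j * q ^ k j) hx hinj, ← Finset.prod_pow_eq_pow_sum]
      congr 1
      exact Finset.prod_congr rfl fun j _ => mul_div_cancel_left₀ _ (hx j)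
    have hsplit : ∑ k ∈ natSimplex ι (N + 1), multiTerm q b c x a k *
        (if ∑ i, k i ≤ N then (1 - w * q ^ N) * simplexWeight q w N (∑ i, k i) else 0) =
        (1 - w * q ^ N) * R := by
      rw [← ih0, Finset.mul_sum]
      symm
      refine Finset.sum_subset_zero_on_sdiff (fun k hk => ?_) (fun k hk => ?_) fun k hk => ?_
      · rw [mem_natSimplex] at hk ⊢
        omega
      · rw [Finset.mem_sdiff, mem_natSimplex, mem_natSimplex] at hk
        rw [if_neg hk.2, mul_zero]
      · rw [mem_natSimplex] at hk
        rw [if_pos hk]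
        ring
    have hshift : ∑ k ∈ natSimplex ι (N + 1), multiTerm q b c x a k *
        ((1 - q ^ ∑ i, k i) * simplexWeight q (w / q) N (∑ i, k i - 1)) =
        ∑ i, d i * (R * ((1 - c * x i) / (1 - c * x i * q ^ N))) := by
      simp only [← hL, Finset.sum_mul, Finset.mul_sum]
      rw [Finset.sum_comm]
      refine Finset.sum_congr rfl fun i _ => ?_
      rw [sum_natSimplex_succ N i, ← ihs i, Finset.mul_sum]
      · refine Finset.sum_congr rfl fun k hk => ?_
        rw [mem_natSimplex] at hk
        have hkj (j : ι) : k j ≤ N + 1 := by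
          have := Finset.single_le_sum (f := k) (fun _ _ => Nat.zero_le _) (mem_univ j)
          omega
        rw [sum_raiseAt, Nat.add_sub_cancel, ← mul_assoc, ← mul_assoc,
          multiTerm_raiseAt q b c x a i k (N + 1) hq hqru hx hxd (by omega) hkj]
      · intro k hk
        have : ∏ j, (1 - x j * q ^ k j / x i) = 0 :=
          Finset.prod_eq_zero (mem_univ i) (by
            rw [hk, pow_zero, mul_one, div_self (hx i), sub_self])
        rw [this]
        ring
    have hrec : (1 - q ^ (N + 1)) * ∑ k ∈ natSimplex ι (N + 1),
        multiTerm q b c x a k * simplexWeight q w (N + 1) (∑ i, k i) =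
        R * ((1 - w * q ^ N) + q ^ N * w * ∑ i, d i * ((1 - c * x i) / (1 - c * x i * q ^ N))) := by
      have : R * ((1 - w * q ^ N) +
          q ^ N * w * ∑ i, d i * ((1 - c * x i) / (1 - c * x i * q ^ N))) =
          (1 - w * q ^ N) * R +
          q ^ N * w * ∑ i, d i * (R * ((1 - c * x i) / (1 - c * x i * q ^ N))) := by
        simp only [mul_left_comm _ R, ← Finset.mul_sum]
        ring
      rw [this, ← hsplit, ← hshift, Finset.mul_sum, Finset.mul_sum, ← Finset.sum_add_distrib]
      refine Finset.sum_congr rfl fun k hk => ?_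
      rw [mem_natSimplex] at hk
      rw [mul_left_comm, simplexWeight_succ hq hqru w hk]
      ring
    have hpf := one_sub_mul_prod_eq_sum x a b (c * q ^ N) hx hinj ha hb
      (mul_ne_zero hc (pow_ne_zero N hq)) fun i => by
        rw [mul_right_comm]
        exact hcxN i
    have hwN : c * q ^ N / ((∏ i, a i) * b) = w * q ^ N := by rw [hw]; ring
    have hdi (i : ι) : d i * ((1 - c * x i) / (1 - c * x i * q ^ N)) =
        (∏ j, (1 - a j * x i / x j)) / (∏ j ∈ univ.erase i, (1 - x i / x j)) *
          ((1 - b * x i) / (1 - c * q ^ N * x i)) := by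
      rw [hd, mul_assoc, div_mul_div_cancel₀ (hcx0 i), mul_right_comm c]
    simp only [hdi] at hrec
    rw [hwN] at hpf
    rw [mul_comm (q ^ N) w, ← hpf] at hrec
    have hq1 : 1 - q ^ (N + 1) ≠ 0 := sub_ne_zero.2 (hqru _ (Nat.succ_pos N)).symm
    apply mul_left_cancel₀ hq1
    have hP : ∏ i, qPoch q (c * x i / a i) (N + 1) / qPoch q (c * x i) (N + 1) =
        (∏ i, qPoch q (c * x i / a i) N / qPoch q (c * x i) N) *
          ∏ i, (1 - c * q ^ N * x i / a i) / (1 - c * q ^ N * x i) := by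
      rw [← Finset.prod_mul_distrib]
      refine Finset.prod_congr rfl fun i _ => ?_
      rw [qPoch_succ, qPoch_succ, mul_div_mul_comm]
      congr 2 <;> ring
    have hQ : qPoch q q (N + 1) = qPoch q q N * (1 - q ^ (N + 1)) := by
      rw [qPoch_succ, pow_succ']
    rw [hrec, hP, hQ, qPoch_succ q (c / b), hR, mul_div_mul_comm]
    have : c / b * q ^ N = c * q ^ N / b := by ring
    rw [this]
    field_simp

theorem qPoch_zpow_neg_mul {q w : ℂ} (hq : q ≠ 0) (hw : w ≠ 0) {N m : ℕ} (hm : m ≤ N) :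
    qPoch q (q ^ (-(N : ℤ))) m * q ^ m * qPoch q w N * qPoch q q (N - m) =
      qPoch q q N * w ^ m * qPoch q w (N - m) * qPoch q (q ^ (1 - (N : ℤ)) / w) m := by
  induction m with
  | zero => simp [qPoch, mul_comm]
  | succ m ih =>
    obtain ⟨r, rfl⟩ := Nat.exists_eq_add_of_le hm
    have e1 : m + 1 + r - m = r + 1 := by omega
    have e2 : m + 1 + r - (m + 1) = r := by omega
    have ih := ih (by omega)
    rw [e1, qPoch_succ q q r, qPoch_succ q w r] at ih
    rw [e2, qPoch_succ _ _ m, qPoch_succ _ _ m]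
    have hr : q ^ r * (q ^ r)⁻¹ = 1 := mul_inv_cancel₀ (pow_ne_zero r hq)
    have f1 : q ^ (-((m + 1 + r : ℕ) : ℤ)) * q ^ m = (q ^ r)⁻¹ * q⁻¹ := by
      rw [← zpow_natCast, ← zpow_natCast, ← zpow_neg, ← zpow_neg_one, ← zpow_add₀ hq,
        ← zpow_add₀ hq]
      congr 1
      push_cast
      ring
    have f2 : q ^ (1 - ((m + 1 + r : ℕ) : ℤ)) / w * q ^ m = (q ^ r)⁻¹ / w := by
      rw [div_mul_eq_mul_div, ← zpow_natCast, ← zpow_natCast, ← zpow_neg, ← zpow_add₀ hq]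
      congr 2
      push_cast
      ring
    rw [f1, f2]
    have hq' : q ^ (m + 1) * (1 - (q ^ r)⁻¹ * q⁻¹) = q ^ m * (-(q ^ r)⁻¹ * (1 - q * q ^ r)) := by
      rw [pow_succ]
      field_simp
      ring
    have hw' : w ^ (m + 1) * (1 - (q ^ r)⁻¹ / w) = w ^ m * (-(q ^ r)⁻¹ * (1 - w * q ^ r)) := by
      rw [pow_succ]
      field_simp
      ring
    linear_combination (-(q ^ r)⁻¹) * ih +
      (qPoch q (q ^ (-((m + 1 + r : ℕ) : ℤ))) m * qPoch q w (m + 1 + r) * qPoch q q r) * hq' -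
      (qPoch q q (m + 1 + r) * qPoch q w r *
        qPoch q (q ^ (1 - ((m + 1 + r : ℕ) : ℤ)) / w) m) * hw'

end Lemmas

/-- `A_n` q-Pfaff–Saalschütz summation over a simplex. -/
theorem stmt_14 (n : ℕ) (hn : 0 < n) (N : ℕ) (q : ℂ) (hq : q ≠ 0)
    (hqru : ∀ m : ℕ, 0 < m → q ^ m ≠ 1)
    (a : Fin n → ℂ) (b c : ℂ) (x : Fin n → ℂ)
    (ha : ∀ i, a i ≠ 0) (hb : b ≠ 0) (hc : c ≠ 0) (hx : ∀ i, x i ≠ 0)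
    (hxd : ∀ i j : Fin n, i ≠ j → x i ≠ x j)
    (hd1 : ∀ i j : Fin n, ∀ m ≤ N, qPoch q (q * x i / x j) m ≠ 0)
    (hd2 : ∀ i : Fin n, ∀ m ≤ N, qPoch q (c * x i) m ≠ 0)
    (hd3 : ∀ m ≤ N,
      qPoch q ((∏ i, a i) * b * q ^ (1 - (N : ℤ)) / c) m ≠ 0)
    (hd4 : qPoch q (c / ((∏ i, a i) * b)) N ≠ 0) :
    ∑ k ∈ Finset.filter (fun k : Fin n → ℕ => ∑ i, k i ≤ N)
        (Fintype.piFinset fun _ => Finset.range (N + 1)),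
      ((∏ i, ∏ j, if i < j then (x i * q ^ k i - x j * q ^ k j) / (x i - x j) else 1) *
        (∏ i, ∏ j, qPoch q (a j * x i / x j) (k i) / qPoch q (q * x i / x j) (k i)) *
        (∏ i, qPoch q (b * x i) (k i) / qPoch q (c * x i) (k i)) *
        (qPoch q (q ^ (-(N : ℤ))) (∑ i, k i) /
          qPoch q ((∏ i, a i) * b * q ^ (1 - (N : ℤ)) / c) (∑ i, k i)) *
        q ^ (∑ i, k i)) =
      qPoch q (c / b) N / qPoch q (c / ((∏ i, a i) * b)) N *
        ∏ i, qPoch q (c * x i / a i) N / qPoch q (c * x i) N := by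
  have hA : ∏ i, a i ≠ 0 := Finset.prod_ne_zero_iff.2 fun i _ => ha i
  set w := c / ((∏ i, a i) * b) with hw
  have hw0 : w ≠ 0 := div_ne_zero hc (mul_ne_zero hA hb)
  have hwinv : (∏ i, a i) * b * q ^ (1 - (N : ℤ)) / c = q ^ (1 - (N : ℤ)) / w := by
    rw [hw]
    field_simp
  rw [hwinv] at hd3 ⊢
  have hxs : ∀ l j, l ≠ j → ∀ s ≤ N, x l * q ^ s ≠ x j := by
    rintro l j hlj (_ | s) hs h
    · exact hxd l j hlj (by simpa using h)
    · refine (qPoch_ne_zero_iff _ _ _).1 (hd1 l j N le_rfl) s (by omega) ?_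
      rw [sub_eq_zero, eq_comm, div_mul_eq_mul_div, div_eq_one_iff_eq (hx j), ← h, pow_succ']
      ring
  have key := sum_multiTerm_mul_simplexWeight hq hqru hb hc N x a hx ha hxs
    fun i => (qPoch_ne_zero_iff _ _ _).1 (hd2 i N le_rfl)
  have hQ := qPoch_self_ne_zero hqru N
  have hR : qPoch q (c / b) N / qPoch q w N *
      ∏ i, qPoch q (c * x i / a i) N / qPoch q (c * x i) N =
      qPoch q q N / qPoch q w N * (qPoch q (c / b) N / qPoch q q N *
        ∏ i, qPoch q (c * x i / a i) N / qPoch q (c * x i) N) := by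
    field_simp
  rw [hR, ← key, Finset.mul_sum]
  refine Finset.sum_congr rfl fun k hk => ?_
  have hkN := (Finset.mem_filter.1 hk).2
  have hF := hd3 _ hkN
  have hQk := qPoch_self_ne_zero hqru (N - ∑ i, k i)
  have hconv : qPoch q (q ^ (-(N : ℤ))) (∑ i, k i) / qPoch q (q ^ (1 - (N : ℤ)) / w) (∑ i, k i) *
      q ^ (∑ i, k i) = qPoch q q N / qPoch q w N * simplexWeight q w N (∑ i, k i) := by
    have h := qPoch_zpow_neg_mul hq hw0 hkN
    rw [simplexWeight, div_mul_eq_mul_div, div_mul_eq_mul_div, div_eq_div_iff hF hd4]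
    apply mul_right_cancel₀ hQk
    rw [h]
    field_simp
  rw [mul_assoc (_ * _ * _), hconv, mul_left_comm]
  rfl
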